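/- Let M₁,...,Mₘ be bounded open subsets of ℝⁿ (with M₂,...,M_{m−1} convex) and Z a bounded open subset of ℝⁿ; let each f_k : cl(M_k) × cl(Z) → ℝ be C², and suppose that for every x ∈ M₁×⋯×Mₘ the function z ↦ Σ_k f_k(x_k,z) attains its infimum over cl(Z) at a unique point z(x) ∈ Z with A(x) = Σ_k D²_{zz}f_k(x_k, z(x)) invertible; assume also that c(x) = inf_{z∈cl(Z)} Σ_k f_k(x_k,z) is (1,m)-non-degenerate. Suppose further that for each i = 2,...,m−1, fᵢ has the separable form fᵢ(xᵢ,z) = xᵢ·αᵢ(z) + βᵢ(xᵢ) + λᵢ(z) with αᵢ : cl(Z) → ℝⁿ, βᵢ, λᵢ C², and with the Jacobian matrix Dαᵢ(z) invertible for every z. Then for every ȳ ∈ M₁×⋯×Mₘ and every choice of points ȳ(i) ∈ cl(M₁)×⋯×cl(Mₘ) with yᵢ(i) = yᵢ (i = 2,...,m−1), the tensor T is block diagonal with T⟨v,v⟩ = −Σ_{i=2}^{m−1} vᵢᵀ Dαᵢ(z(ȳ(i)))ᵀ A(ȳ(i))⁻¹ Dαᵢ(z(ȳ(i))) vᵢ;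 in particular T is negative definite. -/

import Mathlib

open MeasureTheory Finset Matrix

/-- The `n × n` matrix of mixed second partial derivatives of `c` in the blocks
`x i` and `x j`. -/
noncomputable def pD2 {m n : ℕ} (c : (Fin m → Fin n → ℝ) → ℝ) (i j : Fin m)
    (x : Fin m → Fin n → ℝ) : Matrix (Fin n) (Fin n) ℝ :=
  Matrix.of fun a b =>
    fderiv ℝ (fun y => fderiv ℝ c y (Pi.single j (Pi.single b 1))) x
      (Pi.single i (Pi.single a 1))

/-- `(D2zz f xi z) a b = ∂²f/∂zₐ ∂z_b` at `(xi, z)`. -/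
noncomputable def D2zz {n : ℕ} (f : (Fin n → ℝ) → (Fin n → ℝ) → ℝ)
    (xi z : Fin n → ℝ) : Matrix (Fin n) (Fin n) ℝ :=
  Matrix.of fun a b =>
    fderiv ℝ (fun w => fderiv ℝ (fun w' => f xi w') w (Pi.single b 1)) z
      (Pi.single a 1)

/-- The Jacobian matrix of `α : ℝⁿ → ℝⁿ`, with the convention
`(jacobian α z) a b = ∂α_b/∂zₐ`. -/
noncomputable def jacobian {n : ℕ} (α : (Fin n → ℝ) → Fin n → ℝ)
    (z : Fin n → ℝ) : Matrix (Fin n) (Fin n) ℝ :=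
  Matrix.of fun a b => fderiv ℝ (fun w => α w b) z (Pi.single a 1)

/-- The quadratic form `T⟨v,v⟩` of the paper. -/
noncomputable def Ttensor {m n : ℕ} (c : (Fin m → Fin n → ℝ) → ℝ)
    (fst lst : Fin m) (yb : Fin m → Fin n → ℝ) (Y : Fin m → Fin m → Fin n → ℝ)
    (v : Fin m → Fin n → ℝ) : ℝ :=
  -(∑ j ∈ Finset.univ.filter (fun i : Fin m => i ≠ fst ∧ i ≠ lst),
      ∑ i ∈ (Finset.univ.filter (fun i : Fin m => i ≠ fst ∧ i ≠ lst)).erase j,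
        v i ⬝ᵥ (pD2 c i j yb *ᵥ v j))
  + ∑ i ∈ Finset.univ.filter (fun i : Fin m => i ≠ fst ∧ i ≠ lst),
      ∑ j ∈ Finset.univ.filter (fun i : Fin m => i ≠ fst ∧ i ≠ lst),
        v i ⬝ᵥ ((pD2 c i lst yb * (pD2 c fst lst yb)⁻¹ * pD2 c fst j yb) *ᵥ v j)
  + ∑ i ∈ Finset.univ.filter (fun i : Fin m => i ≠ fst ∧ i ≠ lst),
      v i ⬝ᵥ ((pD2 c i i (Y i) - pD2 c i i yb) *ᵥ v i)

open Topology Filter in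
/-- At a local minimum along a line, the second derivative in its direction is nonnegative. -/
theorem fderiv_fderiv_nonneg_of_isLocalMin {E : Type*} [NormedAddCommGroup E] [NormedSpace ℝ E]
    {F : E → ℝ} {p : E} (hF : ContDiffAt ℝ 2 F p) (u : E)
    (hmin : IsLocalMin (fun t : ℝ => F (p + t • u)) 0) :
    0 ≤ fderiv ℝ (fderiv ℝ F) p u u := by
  have hline : ∀ t : ℝ, HasDerivAt (fun t : ℝ => p + t • u) u t := fun t => by
    simpa using ((hasDerivAt_id t).smul_const u).const_add p
  have htend : Tendsto (fun t : ℝ => p + t • u) (𝓝 0) (𝓝 p) := by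
    simpa using (hline 0).continuousAt.tendsto
  have hdF : DifferentiableAt ℝ (fderiv ℝ F) p :=
    (hF.fderiv_right (m := 1) (by norm_num)).differentiableAt (by norm_num)
  have hev : ∀ᶠ t : ℝ in 𝓝 0, deriv (fun t : ℝ => F (p + t • u)) t =
      fderiv ℝ F (p + t • u) u := by
    filter_upwards [htend.eventually (hF.eventually (by simp))] with t ht
    exact ((ht.differentiableAt (by norm_num)).hasFDerivAt.comp_hasDerivAt t (hline t)).deriv
  have hdd : deriv (deriv (fun t : ℝ => F (p + t • u))) 0 = fderiv ℝ (fderiv ℝ F) p u u := by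
    rw [EventuallyEq.deriv_eq hev]
    have h1 : HasFDerivAt (fderiv ℝ F) (fderiv ℝ (fderiv ℝ F) p) (p + (0 : ℝ) • u) := by
      simpa using hdF.hasFDerivAt
    exact ((ContinuousLinearMap.apply ℝ ℝ u).hasFDerivAt.comp_hasDerivAt (0 : ℝ)
      (h1.comp_hasDerivAt (0 : ℝ) (hline 0))).deriv
  by_contra! hneg
  have hmax : IsLocalMax (fun t : ℝ => F (p + t • u)) 0 := by
    refine isLocalMax_of_deriv_deriv_neg (hdd ▸ hneg) hmin.deriv_eq_zero ?_
    refine ContinuousAt.comp (g := F) ?_ (hline 0).continuousAt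
    simpa using hF.continuousAt
  have hconst : (fun t : ℝ => F (p + t • u)) =ᶠ[𝓝 0] fun _ => F p := by
    filter_upwards [hmin, hmax] with t h1 h2
    simpa using le_antisymm h2 h1
  have : deriv (deriv (fun t : ℝ => F (p + t • u))) 0 = 0 := by
    rw [EventuallyEq.deriv_eq hconst.deriv]
    simp
  linarith [hdd]

open Topology Filter in
/-- Envelope theorem with implicit minimizer: near a parameter whose minimizer over the compact
set `K` is unique, interior and nondegenerate, the minimizer is a differentiable function of the
parameter. -/
theorem exists_implicit_minimizer {E G : Type*} [NormedAddCommGroup E] [NormedSpace ℝ E]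
    [CompleteSpace E] [NormedAddCommGroup G] [NormedSpace ℝ G] [CompleteSpace G]
    {F : E × G → ℝ} {K : Set G} (hK : IsCompact K) {x₀ : E} {z₀ : G}
    (hF : ∀ w ∈ K, ContDiffAt ℝ 2 F (x₀, w)) (hz₀ : z₀ ∈ interior K)
    (hmin : ∀ w ∈ K, F (x₀, z₀) ≤ F (x₀, w)) (huniq : ∀ w ∈ K, F (x₀, w) = F (x₀, z₀) → w = z₀)
    (hinv : ((ContinuousLinearMap.compL ℝ G (E × G) ℝ).flip (.inr ℝ E G) ∘L
      fderiv ℝ (fderiv ℝ F) (x₀, z₀) ∘L .inr ℝ E G).IsInvertible)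
    {c : E → ℝ} (hc : ∀ x, c x = sInf {r : ℝ | ∃ w ∈ K, r = F (x, w)}) :
    ∃ ζ : E → G, ζ x₀ = z₀ ∧ DifferentiableAt ℝ ζ x₀ ∧
      (∀ᶠ x in 𝓝 x₀, fderiv ℝ F (x, ζ x) ∘L .inr ℝ E G = 0) ∧
      (∀ᶠ x in 𝓝 x₀, fderiv ℝ c x = fderiv ℝ F (x, ζ x) ∘L .inl ℝ E G) := by
  have hKz : z₀ ∈ K := interior_subset hz₀
  have hF₀ := hF z₀ hKz
  let R := (ContinuousLinearMap.compL ℝ G (E × G) ℝ).flip (.inr ℝ E G)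
  let Φ : E × G → G →L[ℝ] ℝ := fun p => R (fderiv ℝ F p)
  have hdF : ContDiffAt ℝ 1 (fderiv ℝ F) (x₀, z₀) := hF₀.fderiv_right (by norm_num)
  have hΦ : ContDiffAt ℝ 1 Φ (x₀, z₀) := R.contDiff.contDiffAt.comp _ hdF
  have hΦ' : fderiv ℝ Φ (x₀, z₀) = R ∘L fderiv ℝ (fderiv ℝ F) (x₀, z₀) :=
    (R.hasFDerivAt.comp _ (hdF.differentiableAt (by norm_num)).hasFDerivAt).fderiv
  have hi : (fderiv ℝ Φ (x₀, z₀) ∘L .inr ℝ E G).IsInvertible := by rw [hΦ']; exact hinv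
  have hcrit : ∀ x : E, ∀ z ∈ interior K, ContDiffAt ℝ 2 F (x, z) →
      (∀ w ∈ K, F (x, z) ≤ F (x, w)) → Φ (x, z) = 0 := by
    intro x z hz hd hm
    have h1 : IsLocalMin (fun w => F (x, w)) z := by
      filter_upwards [mem_interior_iff_mem_nhds.1 hz] with w hw using hm w hw
    have h2 : HasFDerivAt (fun w => F (x, w)) (fderiv ℝ F (x, z) ∘L .inr ℝ E G) z :=
      (hd.differentiableAt (by norm_num)).hasFDerivAt.comp z (hasFDerivAt_prodMk_right x z)
    exact h1.hasFDerivAt_eq_zero h2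
  have hΦ0 : Φ (x₀, z₀) = 0 := hcrit x₀ z₀ hz₀ hF₀ hmin
  let ζ := hΦ.implicitFunction one_ne_zero hi
  have hζ0 : ζ x₀ = z₀ := hΦ.implicitFunction_apply_self one_ne_zero hi
  have hζd : ContDiffAt ℝ 1 ζ x₀ := hΦ.contDiffAt_implicitFunction one_ne_zero hi
  have hζz : ∀ᶠ x in 𝓝 x₀, Φ (x, ζ x) = 0 := by
    simpa [hΦ0] using hΦ.eventually_apply_implicitFunction one_ne_zero hi
  have hζu : ∀ᶠ v in 𝓝 (x₀, z₀), Φ v = 0 → ζ v.1 = v.2 := by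
    filter_upwards [hΦ.eventually_apply_eq_iff_implicitFunction one_ne_zero hi] with v hv h
    exact hv.1 (h.trans hΦ0.symm)
  rw [nhds_prod_eq] at hζu
  obtain ⟨P, hP, Q, hQ, hPQ⟩ := eventually_prod_iff.1 hζu
  obtain ⟨N, hNQ, hNo, hzN⟩ := eventually_nhds_iff.1
    (hQ.and (isOpen_interior.eventually_mem hz₀))
  have hfar : ∀ᶠ x in 𝓝 x₀, ∀ w ∈ K \ N, F (x, z₀) < F (x, w) := by
    refine (hK.diff hNo).eventually_forall_of_forall_eventually fun w hw => ?_
    have h1 : ContinuousAt (fun p : E × G => F (p.1, z₀)) (x₀, w) :=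
      ContinuousAt.comp (g := F) (f := fun p : E × G => (p.1, z₀)) hF₀.continuousAt (by fun_prop)
    refine h1.eventually_lt (hF w hw.1).continuousAt (lt_of_le_of_ne (hmin w hw.1) fun h => ?_)
    exact hw.2 (huniq w hw.1 h.symm ▸ hzN)
  have hsm : ∀ᶠ x in 𝓝 x₀, ∀ w ∈ K, ContDiffAt ℝ 2 F (x, w) :=
    hK.eventually_forall_of_forall_eventually fun w hw => (hF w hw).eventually (by simp)
  have hcζ : ∀ᶠ x in 𝓝 x₀, c x = F (x, ζ x) ∧ ζ x ∈ K := by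
    filter_upwards [hfar, hsm, hP] with x hx hxs hxP
    obtain ⟨w, hwK, hw⟩ := hK.exists_isMinOn ⟨z₀, hKz⟩
      (f := fun w => F (x, w)) fun w hw =>
        (ContinuousAt.comp (g := F) (f := fun w => (x, w)) (hxs w hw).continuousAt
          (by fun_prop)).continuousWithinAt
    have hwm : ∀ w' ∈ K, F (x, w) ≤ F (x, w') := fun w' hw' => hw hw'
    have hwN : w ∈ N := by
      by_contra h
      exact absurd (hx w ⟨hwK, h⟩) (not_lt.2 (hwm z₀ hKz))
    have hζw : ζ x = w := hPQ hxP (hNQ w hwN).1 (hcrit x w (hNQ w hwN).2 (hxs w hwK) hwm)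
    rw [hζw, hc]
    refine ⟨IsLeast.csInf_eq ⟨⟨w, hwK, rfl⟩, ?_⟩, hwK⟩
    rintro _ ⟨w', hw', rfl⟩
    exact hwm w' hw'
  refine ⟨ζ, hζ0, hζd.differentiableAt (by norm_num), hζz, ?_⟩
  filter_upwards [hcζ.eventually_nhds, hsm, hζz, hζd.eventually (by simp)] with x hx hxs hxz hxd
  have hζx := (hxd.differentiableAt (by norm_num)).hasFDerivAt
  have hFx := ((hxs _ hx.self_of_nhds.2).differentiableAt (by norm_num)).hasFDerivAt
  have hcx : c =ᶠ[𝓝 x] fun x => F (x, ζ x) := hx.mono fun _ h => h.1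
  have hcomp : HasFDerivAt (fun x => F (x, ζ x)) _ x :=
    hFx.comp (f := fun x => (x, ζ x)) x ((hasFDerivAt_id x).prodMk hζx)
  rw [hcx.fderiv_eq, hcomp.fderiv]
  ext u
  have h0 : fderiv ℝ F (x, ζ x) (0, fderiv ℝ ζ x u) = 0 := DFunLike.congr_fun hxz _
  have hsplit : ((u, fderiv ℝ ζ x u) : E × G) = (u, 0) + (0, fderiv ℝ ζ x u) := by simp
  change fderiv ℝ F (x, ζ x) (u, fderiv ℝ ζ x u) = fderiv ℝ F (x, ζ x) (u, 0)
  rw [hsplit, map_add, h0, add_zero]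

open Topology Filter in
/-- The second derivatives of a minimal value, in terms of those of the objective and of the
derivative `S` of the minimizer. -/
theorem exists_fderiv_fderiv_minimum {E G : Type*} [NormedAddCommGroup E] [NormedSpace ℝ E]
    [CompleteSpace E] [NormedAddCommGroup G] [NormedSpace ℝ G] [CompleteSpace G]
    {F : E × G → ℝ} {K : Set G} (hK : IsCompact K) {x₀ : E} {z₀ : G}
    (hF : ∀ w ∈ K, ContDiffAt ℝ 2 F (x₀, w)) (hz₀ : z₀ ∈ interior K)
    (hmin : ∀ w ∈ K, F (x₀, z₀) ≤ F (x₀, w)) (huniq : ∀ w ∈ K, F (x₀, w) = F (x₀, z₀) → w = z₀)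
    (hinv : ((ContinuousLinearMap.compL ℝ G (E × G) ℝ).flip (.inr ℝ E G) ∘L
      fderiv ℝ (fderiv ℝ F) (x₀, z₀) ∘L .inr ℝ E G).IsInvertible)
    {c : E → ℝ} (hc : ∀ x, c x = sInf {r : ℝ | ∃ w ∈ K, r = F (x, w)}) :
    ∃ S : E →L[ℝ] G, (∀ u e, fderiv ℝ (fderiv ℝ F) (x₀, z₀) (u, S u) (0, e) = 0) ∧
      ∀ u v, fderiv ℝ (fun y => fderiv ℝ c y v) x₀ u =
        fderiv ℝ (fderiv ℝ F) (x₀, z₀) (u, S u) (v, 0) := by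
  obtain ⟨ζ, rfl, hζ, h2, h1⟩ := exists_implicit_minimizer hK hF hz₀ hmin huniq hinv hc
  have hdF : DifferentiableAt ℝ (fderiv ℝ F) (x₀, ζ x₀) :=
    ((hF _ (interior_subset hz₀)).fderiv_right (m := 1) (by norm_num)).differentiableAt
      (by norm_num)
  have hd : ∀ q : E × G, HasFDerivAt (fun x => fderiv ℝ F (x, ζ x) q)
      (ContinuousLinearMap.apply ℝ ℝ q ∘L fderiv ℝ (fderiv ℝ F) (x₀, ζ x₀) ∘L
        (ContinuousLinearMap.id ℝ E).prod (fderiv ℝ ζ x₀)) x₀ := fun q =>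
    (ContinuousLinearMap.apply ℝ ℝ q).hasFDerivAt.comp x₀
      (hdF.hasFDerivAt.comp (f := fun x => (x, ζ x)) x₀
        ((hasFDerivAt_id x₀).prodMk hζ.hasFDerivAt))
  refine ⟨fderiv ℝ ζ x₀, fun u e => ?_, fun u v => ?_⟩
  · have h0 : (fun x => fderiv ℝ F (x, ζ x) (0, e)) =ᶠ[𝓝 x₀] fun _ => 0 :=
      h2.mono fun x hx => DFunLike.congr_fun hx e
    have := DFunLike.congr_fun ((hd (0, e)).fderiv.symm.trans h0.fderiv_eq) u
    simpa using this
  · have h0 : (fun x => fderiv ℝ c x v) =ᶠ[𝓝 x₀] fun x => fderiv ℝ F (x, ζ x) (v, 0) :=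
      h1.mono fun x hx => DFunLike.congr_fun hx v
    rw [h0.fderiv_eq, (hd (v, 0)).fderiv]
    rfl

open Topology Filter in
/-- The second derivative of a finite sum of functions precomposed with linear maps. -/
theorem fderiv_fderiv_sum_comp {ι E G : Type*} [Fintype ι] [NormedAddCommGroup E]
    [NormedSpace ℝ E] [NormedAddCommGroup G] [NormedSpace ℝ G] {g : ι → G → ℝ}
    (L : ι → E →L[ℝ] G) {p : E} (hg : ∀ k, ContDiffAt ℝ 2 (g k) (L k p)) (u v : E) :
    fderiv ℝ (fderiv ℝ fun q => ∑ k, g k (L k q)) p u v =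
      ∑ k, fderiv ℝ (fderiv ℝ (g k)) (L k p) (L k u) (L k v) := by
  have h1 : fderiv ℝ (fun q => ∑ k, g k (L k q)) =ᶠ[𝓝 p]
      fun q => ∑ k, (ContinuousLinearMap.compL ℝ E G ℝ).flip (L k) (fderiv ℝ (g k) (L k q)) := by
    have : ∀ᶠ q in 𝓝 p, ∀ k, ContDiffAt ℝ 2 (g k) (L k q) :=
      eventually_all.2 fun k =>
        (L k).continuous.continuousAt.eventually ((hg k).eventually (by simp))
    filter_upwards [this] with q hq
    exact (HasFDerivAt.fun_sum fun k _ =>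
      ((hq k).differentiableAt (by norm_num)).hasFDerivAt.comp q (L k).hasFDerivAt).fderiv
  have h2 : HasFDerivAt
      (fun q => ∑ k, (ContinuousLinearMap.compL ℝ E G ℝ).flip (L k) (fderiv ℝ (g k) (L k q)))
      (∑ k, (ContinuousLinearMap.compL ℝ E G ℝ).flip (L k) ∘L
        fderiv ℝ (fderiv ℝ (g k)) (L k p) ∘L L k) p :=
    HasFDerivAt.fun_sum fun k _ => ContinuousLinearMap.hasFDerivAt _ |>.comp p
      ((((hg k).fderiv_right (m := 1) (by norm_num)).differentiableAt
        (by norm_num)).hasFDerivAt.comp p (L k).hasFDerivAt)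
  rw [h1.fderiv_eq, h2.fderiv]
  simp

/-- A linear functional on `ℝⁿ` in coordinates. -/
theorem apply_eq_sum_single {n : ℕ} (L : (Fin n → ℝ) →L[ℝ] ℝ) (s : Fin n → ℝ) :
    L s = ∑ a, s a * L (Pi.single a 1) := by
  conv_lhs => rw [← Finset.univ_sum_single s, map_sum]
  refine Finset.sum_congr rfl fun a _ => ?_
  rw [← smul_eq_mul, ← map_smul, ← Pi.single_smul, smul_eq_mul, mul_one]

/-- A bilinear form whose matrix is invertible is an isomorphism onto the dual. -/
theorem isInvertible_of_isUnit_matrix {n : ℕ} (L : (Fin n → ℝ) →L[ℝ] (Fin n → ℝ) →L[ℝ] ℝ)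
    (h : IsUnit (Matrix.of fun a b => L (Pi.single a 1) (Pi.single b 1))) :
    L.IsInvertible := by
  have hinj : Function.Injective L := by
    refine (injective_iff_map_eq_zero L).2 fun s hs => ?_
    refine Matrix.vecMul_injective_of_isUnit h ?_
    ext b
    have := apply_eq_sum_single (L.flip (Pi.single b 1)) s
    simpa [Matrix.vecMul, dotProduct, hs] using this.symm
  have hfin : Module.finrank ℝ (Fin n → ℝ) = Module.finrank ℝ ((Fin n → ℝ) →L[ℝ] ℝ) := by
    rw [← (LinearMap.toContinuousLinearMap (𝕜 := ℝ) (E := Fin n → ℝ) (F' := ℝ)).finrank_eq]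
    exact (Subspace.dual_finrank_eq (K := ℝ)).symm
  let e := LinearEquiv.ofInjectiveOfFinrankEq (L : (Fin n → ℝ) →ₗ[ℝ] (Fin n → ℝ) →L[ℝ] ℝ)
    hinj hfin
  exact ⟨e.toContinuousLinearEquiv, by ext; rfl⟩

open Topology Filter in
theorem D2zz_apply {n : ℕ} {f : (Fin n → ℝ) → (Fin n → ℝ) → ℝ} {x z : Fin n → ℝ}
    (hf : ContDiffAt ℝ 2 (fun p : (Fin n → ℝ) × (Fin n → ℝ) => f p.1 p.2) (x, z)) (a b : Fin n) :
    D2zz f x z a b = fderiv ℝ (fderiv ℝ fun p : (Fin n → ℝ) × (Fin n → ℝ) => f p.1 p.2) (x, z)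
      (0, Pi.single a 1) (0, Pi.single b 1) := by
  set g := fun p : (Fin n → ℝ) × (Fin n → ℝ) => f p.1 p.2
  have h1 : (fun w => fderiv ℝ (fun w' => f x w') w (Pi.single b 1)) =ᶠ[𝓝 z]
      fun w => fderiv ℝ g (x, w) (0, Pi.single b 1) := by
    have : ContinuousAt (fun w => (x, w)) z := by fun_prop
    filter_upwards [this.eventually (hf.eventually (by simp))] with w hw
    have h : HasFDerivAt (fun w' => f x w') _ w :=
      (hw.differentiableAt (by norm_num)).hasFDerivAt.comp w (hasFDerivAt_prodMk_right x w)
    rw [h.fderiv]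
    rfl
  have h2 := (ContinuousLinearMap.apply ℝ ℝ ((0, Pi.single b 1) :
    (Fin n → ℝ) × (Fin n → ℝ))).hasFDerivAt.comp z
    (((hf.fderiv_right (m := 1) (by norm_num)).differentiableAt
      (by norm_num)).hasFDerivAt.comp z (hasFDerivAt_prodMk_right x z))
  have h3 : HasFDerivAt (fun w => fderiv ℝ g (x, w) (0, Pi.single b 1)) _ z := h2
  rw [D2zz, Matrix.of_apply, h1.fderiv_eq, h3.fderiv]
  rfl

/-- The matrix of second partial derivatives `∂²f/∂zₐ∂x_b` at `(x, z)`. -/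
noncomputable def D2zx {n : ℕ} (f : (Fin n → ℝ) → (Fin n → ℝ) → ℝ) (x z : Fin n → ℝ) :
    Matrix (Fin n) (Fin n) ℝ :=
  Matrix.of fun a b => fderiv ℝ (fderiv ℝ fun p : (Fin n → ℝ) × (Fin n → ℝ) => f p.1 p.2) (x, z)
    (0, Pi.single a 1) (Pi.single b 1, 0)

/-- The matrix of second partial derivatives `∂²f/∂xₐ∂x_b` at `(x, z)`. -/
noncomputable def D2xx {n : ℕ} (f : (Fin n → ℝ) → (Fin n → ℝ) → ℝ) (x z : Fin n → ℝ) :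
    Matrix (Fin n) (Fin n) ℝ :=
  Matrix.of fun a b => fderiv ℝ (fderiv ℝ fun p : (Fin n → ℝ) × (Fin n → ℝ) => f p.1 p.2) (x, z)
    (Pi.single a 1, 0) (Pi.single b 1, 0)

/-- Second derivatives of a separable function, one of them in the first variable. -/
theorem fderiv_fderiv_separable {n : ℕ} {f : (Fin n → ℝ) → (Fin n → ℝ) → ℝ}
    {α : (Fin n → ℝ) → Fin n → ℝ} {β lam : (Fin n → ℝ) → ℝ} (hα : ContDiff ℝ 2 α)
    (hβ : ContDiff ℝ 2 β) (hlam : ContDiff ℝ 2 lam)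
    (hsep : ∀ x w, f x w = x ⬝ᵥ α w + β x + lam w) (x z u : Fin n → ℝ) (b : Fin n) (s : Fin n → ℝ) :
    fderiv ℝ (fderiv ℝ fun p : (Fin n → ℝ) × (Fin n → ℝ) => f p.1 p.2) (x, z) (u, s)
      (Pi.single b 1, 0) =
      fderiv ℝ (fun w => α w b) z s + fderiv ℝ (fderiv ℝ β) x u (Pi.single b 1) := by
  set g := fun p : (Fin n → ℝ) × (Fin n → ℝ) => f p.1 p.2 with hg
  have hgd : ContDiff ℝ 2 g := by
    simp only [hg, hsep, dotProduct]
    fun_prop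
  have hαb : ContDiff ℝ 2 fun w => α w b := by fun_prop
  have h1 : (fun p => fderiv ℝ g p (Pi.single b 1, 0)) =
      fun p => α p.2 b + fderiv ℝ β p.1 (Pi.single b 1) := by
    ext ⟨y, w⟩
    have ha : HasFDerivAt (fun y' => g (y', w)) _ y :=
      HasFDerivAt.comp (g := g) (f := fun y' => (y', w)) y
        ((hgd.differentiable (by norm_num)) (y, w)).hasFDerivAt (hasFDerivAt_prodMk_left y w)
    have hb : HasFDerivAt (fun y' => g (y', w))
        ((∑ k, α w k • ContinuousLinearMap.proj (R := ℝ) (φ := fun _ : Fin n => ℝ) k)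
          + fderiv ℝ β y) y := by
      simp only [hg, hsep, dotProduct]
      refine ((HasFDerivAt.fun_sum fun k _ => ?_).add
        ((hβ.differentiable (by norm_num)) y).hasFDerivAt).add_const _
      exact (hasFDerivAt_apply k y).mul_const (α w k)
    have := DFunLike.congr_fun (ha.unique hb) (Pi.single b 1)
    simpa [Pi.single_apply] using this
  have h2 : HasFDerivAt (fun p => fderiv ℝ g p (Pi.single b 1, 0)) _ (x, z) :=
    (ContinuousLinearMap.apply ℝ ℝ ((Pi.single b 1, 0) :
      (Fin n → ℝ) × (Fin n → ℝ))).hasFDerivAt.comp (x, z)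
      ((hgd.fderiv_right (m := 1) (by norm_num)).differentiable (by norm_num) (x, z)).hasFDerivAt
  have h3 : HasFDerivAt (fun p : (Fin n → ℝ) × (Fin n → ℝ) =>
      α p.2 b + fderiv ℝ β p.1 (Pi.single b 1)) _ (x, z) :=
    (HasFDerivAt.comp (g := fun w => α w b) (f := Prod.snd) (x, z)
      ((hαb.differentiable (by norm_num)) z).hasFDerivAt hasFDerivAt_snd).fun_add
      ((ContinuousLinearMap.apply ℝ ℝ (Pi.single b 1 : Fin n → ℝ)).hasFDerivAt.comp (x, z)
        (HasFDerivAt.comp (g := fderiv ℝ β) (f := Prod.fst) (x, z)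
          (((hβ.fderiv_right (m := 1) (by norm_num)).differentiable
            (by norm_num) x)).hasFDerivAt hasFDerivAt_fst))
  rw [h1] at h2
  exact DFunLike.congr_fun (h2.unique h3) (u, s)

/-- The second derivative of `(x, z) ↦ ∑ k, f k (x k) z` in terms of those of the summands. -/
theorem fderiv_fderiv_sum_apply {m n : ℕ} {f : Fin m → (Fin n → ℝ) → (Fin n → ℝ) → ℝ}
    {x : Fin m → Fin n → ℝ} {z : Fin n → ℝ}
    (hf : ∀ k, ContDiffAt ℝ 2 (fun p : (Fin n → ℝ) × (Fin n → ℝ) => f k p.1 p.2) (x k, z))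
    (u v : (Fin m → Fin n → ℝ) × (Fin n → ℝ)) :
    fderiv ℝ (fderiv ℝ fun p : (Fin m → Fin n → ℝ) × (Fin n → ℝ) => ∑ k, f k (p.1 k) p.2)
      (x, z) u v = ∑ k, fderiv ℝ (fderiv ℝ fun p : (Fin n → ℝ) × (Fin n → ℝ) => f k p.1 p.2)
        (x k, z) (u.1 k, u.2) (v.1 k, v.2) :=
  fderiv_fderiv_sum_comp (g := fun k p => f k p.1 p.2)
    (fun k => ((ContinuousLinearMap.proj k).comp (.fst ℝ _ _)).prod (.snd ℝ _ _)) hf u v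

theorem contDiffAt_sum_apply {m n : ℕ} {f : Fin m → (Fin n → ℝ) → (Fin n → ℝ) → ℝ}
    {x : Fin m → Fin n → ℝ} {z : Fin n → ℝ}
    (hf : ∀ k, ContDiffAt ℝ 2 (fun p : (Fin n → ℝ) × (Fin n → ℝ) => f k p.1 p.2) (x k, z)) :
    ContDiffAt ℝ 2 (fun p : (Fin m → Fin n → ℝ) × (Fin n → ℝ) => ∑ k, f k (p.1 k) p.2) (x, z) :=
  ContDiffAt.sum fun k _ => ContDiffAt.comp
    (g := fun p : (Fin n → ℝ) × (Fin n → ℝ) => f k p.1 p.2)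
    (f := fun p : (Fin m → Fin n → ℝ) × (Fin n → ℝ) => (p.1 k, p.2)) (x, z) (hf k) (by fun_prop)

/-- The second derivatives of the hedonic-pricing cost. -/
theorem pD2_eq {m n : ℕ} {f : Fin m → (Fin n → ℝ) → (Fin n → ℝ) → ℝ} {K : Set (Fin n → ℝ)}
    (hK : IsCompact K) {x : Fin m → Fin n → ℝ} {z : Fin n → ℝ}
    (hf : ∀ k, ∀ w ∈ K,
      ContDiffAt ℝ 2 (fun p : (Fin n → ℝ) × (Fin n → ℝ) => f k p.1 p.2) (x k, w))
    (hz : z ∈ interior K) (hmin : ∀ w ∈ K, ∑ k, f k (x k) z ≤ ∑ k, f k (x k) w)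
    (huniq : ∀ w ∈ K, ∑ k, f k (x k) w = ∑ k, f k (x k) z → w = z)
    (hA : IsUnit (∑ k, D2zz (f k) (x k) z)) {c : (Fin m → Fin n → ℝ) → ℝ}
    (hc : ∀ x, c x = sInf {r : ℝ | ∃ w ∈ K, r = ∑ k, f k (x k) w}) (i j : Fin m) :
    pD2 c i j x = (if i = j then D2xx (f i) (x i) z else 0) -
      (D2zx (f i) (x i) z)ᵀ * (∑ k, D2zz (f k) (x k) z)⁻¹ * D2zx (f j) (x j) z := by
  set F := fun p : (Fin m → Fin n → ℝ) × (Fin n → ℝ) => ∑ k, f k (p.1 k) p.2 with hF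
  set A := ∑ k, D2zz (f k) (x k) z with hAdef
  have hfz := fun k => hf k z (interior_subset hz)
  set H := fderiv ℝ (fderiv ℝ F) (x, z) with hH
  have hHsum : ∀ u v, H u v = _ := fderiv_fderiv_sum_apply hfz
  have hHA : ∀ a b, H (0, Pi.single a 1) (0, Pi.single b 1) = A a b := fun a b => by
    rw [hHsum, hAdef, Matrix.sum_apply]
    exact Finset.sum_congr rfl fun k _ => (D2zz_apply (hfz k) a b).symm
  have hne : ∀ (b : Fin n) {j k : Fin m}, k ≠ j →
      (((Pi.single j (Pi.single b 1) : Fin m → Fin n → ℝ) k, 0) : (Fin n → ℝ) × (Fin n → ℝ)) = 0 :=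
    fun b j k h => by rw [Pi.single_eq_of_ne h]; rfl
  have hHB : ∀ a b j, H (0, Pi.single a 1) (Pi.single j (Pi.single b 1), 0) =
      D2zx (f j) (x j) z a b := fun a b j => by
    rw [hHsum, Finset.sum_eq_single j]
    · simp [D2zx]
    · intro k _ hk
      rw [hne b hk, map_zero]
    · simp
  have hHD : ∀ a b i j, H (Pi.single i (Pi.single a 1), 0) (Pi.single j (Pi.single b 1), 0) =
      (if i = j then D2xx (f i) (x i) z else 0) a b := fun a b i j => by
    rw [hHsum, Finset.sum_eq_single j]
    · split_ifs with h
      · subst h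
        simp [D2xx]
      · rw [hne a (Ne.symm h), map_zero]
        rfl
    · intro k _ hk
      rw [hne b hk, map_zero]
    · simp
  have hsymm : ∀ u v, H u v = H v u :=
    (contDiffAt_sum_apply hfz).isSymmSndFDerivAt (by simp)
  have hinv : ((ContinuousLinearMap.compL ℝ (Fin n → ℝ) ((Fin m → Fin n → ℝ) × (Fin n → ℝ))
      ℝ).flip (.inr ℝ _ _) ∘L H ∘L .inr ℝ _ _).IsInvertible := by
    refine isInvertible_of_isUnit_matrix _ ?_
    convert hA using 1
    ext a b
    exact hHA a b
  obtain ⟨S, hS, hcS⟩ := exists_fderiv_fderiv_minimum hK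
    (fun w hw => contDiffAt_sum_apply fun k => hf k w hw) hz hmin huniq hinv hc
  have hsplit : ∀ u s v, H (u, s) v = H (u, 0) v + ∑ a, s a * H (0, Pi.single a 1) v :=
    fun u s v => by
      have h1 := apply_eq_sum_single
        (H.flip v ∘L .inr ℝ (Fin m → Fin n → ℝ) (Fin n → ℝ)) s
      have h2 : ((u, s) : (Fin m → Fin n → ℝ) × (Fin n → ℝ)) = (u, 0) + (0, s) := by simp
      rw [h2, map_add]
      exact congrArg (H (u, 0) v + ·) h1
  let P : Matrix (Fin n) (Fin n) ℝ := Matrix.of fun a b => S (Pi.single i (Pi.single a 1)) b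
  have hPA : P * A = -(D2zx (f i) (x i) z)ᵀ := by
    ext a b
    have h := hS (Pi.single i (Pi.single a 1)) (Pi.single b 1)
    rw [hsplit, hsymm, hHB] at h
    simp only [hHA] at h
    rw [Matrix.mul_apply, Matrix.neg_apply, Matrix.transpose_apply]
    exact eq_neg_of_add_eq_zero_right h
  have hP : P = -(D2zx (f i) (x i) z)ᵀ * A⁻¹ := by
    rw [← hPA, Matrix.mul_assoc, Matrix.mul_nonsing_inv _ ((Matrix.isUnit_iff_isUnit_det _).1 hA),
      Matrix.mul_one]
  rw [sub_eq_add_neg, ← Matrix.neg_mul, ← Matrix.neg_mul, ← hP]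
  ext a b
  rw [pD2, Matrix.of_apply, hcS, hsplit, hHD, Matrix.add_apply, Matrix.mul_apply]
  simp only [hHB]
  rfl

open Topology Filter in
/-- The Hessian in `z` at a nondegenerate interior minimum is positive definite. -/
theorem posDef_sum_D2zz {m n : ℕ} {f : Fin m → (Fin n → ℝ) → (Fin n → ℝ) → ℝ}
    {x : Fin m → Fin n → ℝ} {z : Fin n → ℝ}
    (hf : ∀ k, ContDiffAt ℝ 2 (fun p : (Fin n → ℝ) × (Fin n → ℝ) => f k p.1 p.2) (x k, z))
    (hmin : IsLocalMin (fun w => ∑ k, f k (x k) w) z)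
    (hA : IsUnit (∑ k, D2zz (f k) (x k) z)) : (∑ k, D2zz (f k) (x k) z).PosDef := by
  set F := fun p : (Fin m → Fin n → ℝ) × (Fin n → ℝ) => ∑ k, f k (p.1 k) p.2 with hF
  set A := ∑ k, D2zz (f k) (x k) z with hAdef
  set H := fderiv ℝ (fderiv ℝ F) (x, z) with hH
  have hHA : ∀ a b, H (0, Pi.single a 1) (0, Pi.single b 1) = A a b := fun a b => by
    rw [hH, fderiv_fderiv_sum_apply hf, hAdef, Matrix.sum_apply]
    exact Finset.sum_congr rfl fun k _ => (D2zz_apply (hf k) a b).symm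
  have hsymm : ∀ u v, H u v = H v u :=
    (contDiffAt_sum_apply hf).isSymmSndFDerivAt (by simp)
  refine (Matrix.PosSemidef.posDef_iff_isUnit ?_).2 hA
  refine Matrix.PosSemidef.of_dotProduct_mulVec_nonneg ?_ fun s => ?_
  · ext a b
    rw [Matrix.conjTranspose_apply, star_trivial, ← hHA, ← hHA, hsymm]
  · have h1 : IsLocalMin (fun t : ℝ => F ((x, z) + t • (0, s))) 0 := by
      have ht : Tendsto (fun t : ℝ => z + t • s) (𝓝 0) (𝓝 z) := by
        have : Continuous fun t : ℝ => z + t • s := by fun_prop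
        simpa using this.tendsto 0
      filter_upwards [ht.eventually hmin] with t h
      simpa [hF] using h
    have h2 := fderiv_fderiv_nonneg_of_isLocalMin (contDiffAt_sum_apply hf) _ h1
    have h3 := apply_eq_sum_single
      (H.flip (0, s) ∘L .inr ℝ (Fin m → Fin n → ℝ) (Fin n → ℝ)) s
    refine h2.trans_eq (h3.trans ?_)
    rw [star_trivial, dotProduct]
    refine Finset.sum_congr rfl fun a _ => ?_
    have h4 := apply_eq_sum_single
      (H (0, Pi.single a 1) ∘L .inr ℝ (Fin m → Fin n → ℝ) (Fin n → ℝ)) s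
    refine congrArg (s a * ·) (h4.trans ?_)
    rw [Matrix.mulVec, dotProduct]
    refine Finset.sum_congr rfl fun b _ => ?_
    rw [← hHA, mul_comm]
    rfl

theorem mul_nonsing_inv_mul_cancel_middle {n : ℕ} {X Y : Matrix (Fin n) (Fin n) ℝ}
    (h : IsUnit (X * Y)) : Y * (X * Y)⁻¹ * X = 1 := by
  rw [mul_eq_one_comm, ← Matrix.mul_assoc]
  exact Matrix.mul_nonsing_inv _ ((Matrix.isUnit_iff_isUnit_det _).1 h)

theorem D2zx_eq_jacobian {n : ℕ} {f : (Fin n → ℝ) → (Fin n → ℝ) → ℝ}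
    {α : (Fin n → ℝ) → Fin n → ℝ} {β lam : (Fin n → ℝ) → ℝ} (hα : ContDiff ℝ 2 α)
    (hβ : ContDiff ℝ 2 β) (hlam : ContDiff ℝ 2 lam)
    (hsep : ∀ x w, f x w = x ⬝ᵥ α w + β x + lam w) (x z : Fin n → ℝ) :
    D2zx f x z = jacobian α z := by
  ext a b
  simp [D2zx, jacobian, fderiv_fderiv_separable hα hβ hlam hsep]

theorem D2xx_eq_of_separable {n : ℕ} {f : (Fin n → ℝ) → (Fin n → ℝ) → ℝ}
    {α : (Fin n → ℝ) → Fin n → ℝ} {β lam : (Fin n → ℝ) → ℝ} (hα : ContDiff ℝ 2 α)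
    (hβ : ContDiff ℝ 2 β) (hlam : ContDiff ℝ 2 lam)
    (hsep : ∀ x w, f x w = x ⬝ᵥ α w + β x + lam w) (x z z' : Fin n → ℝ) :
    D2xx f x z = D2xx f x z' := by
  ext a b
  simp [D2xx, fderiv_fderiv_separable hα hβ hlam hsep]

/-- **The tensor `T` for the hedonic-pricing cost with separable middle
potentials.** If `f i (xi, z) = xi · α i z + β i xi + λ i z` for the middle
indices `i = 2, …, m − 1`, with `Dα i` invertible, then `T` is block diagonal
with `T⟨v,v⟩ = −Σ_i vᵢᵀ (Dαᵢ)ᵀ A(ȳ(i))⁻¹ (Dαᵢ) vᵢ` (the Jacobians being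
evaluated at `z(ȳ(i))`); in particular `T` is negative definite. -/
theorem hedonic_tensor {m n : ℕ} (hm : 2 ≤ m)
    (M : Fin m → Set (Fin n → ℝ)) (hMo : ∀ i, IsOpen (M i))
    (hMb : ∀ i, Bornology.IsBounded (M i))
    (fst lst : Fin m) (hfst : (fst : ℕ) = 0) (hlst : (lst : ℕ) = m - 1)
    (hconv : ∀ i, i ≠ fst → i ≠ lst → Convex ℝ (M i))
    (Z : Set (Fin n → ℝ)) (hZo : IsOpen Z) (hZb : Bornology.IsBounded Z)
    (f : Fin m → (Fin n → ℝ) → (Fin n → ℝ) → ℝ)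
    (hf : ∀ k, ∃ U : Set ((Fin n → ℝ) × (Fin n → ℝ)), IsOpen U ∧
      closure (M k) ×ˢ closure Z ⊆ U ∧
      ContDiffOn ℝ 2 (fun p : (Fin n → ℝ) × (Fin n → ℝ) => f k p.1 p.2) U)
    (zmin : (Fin m → Fin n → ℝ) → Fin n → ℝ)
    (hzZ : ∀ x : Fin m → Fin n → ℝ, (∀ k, x k ∈ closure (M k)) → zmin x ∈ Z)
    (hzmin : ∀ x : Fin m → Fin n → ℝ, (∀ k, x k ∈ closure (M k)) → ∀ w ∈ closure Z,
      ∑ k, f k (x k) (zmin x) ≤ ∑ k, f k (x k) w)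
    (hzuniq : ∀ x : Fin m → Fin n → ℝ, (∀ k, x k ∈ closure (M k)) → ∀ w ∈ closure Z,
      ∑ k, f k (x k) w = ∑ k, f k (x k) (zmin x) → w = zmin x)
    (hA : ∀ x : Fin m → Fin n → ℝ, (∀ k, x k ∈ closure (M k)) →
      IsUnit (∑ k, D2zz (f k) (x k) (zmin x)))
    (c : (Fin m → Fin n → ℝ) → ℝ)
    (hcdef : ∀ x, c x = sInf {r : ℝ | ∃ w ∈ closure Z, r = ∑ k, f k (x k) w})
    -- `c` is (1,m)-non-degenerate
    (hnd : ∀ x : Fin m → Fin n → ℝ, (∀ k, x k ∈ M k) → IsUnit (pD2 c fst lst x))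
    -- the middle potentials are separable
    (α : Fin m → (Fin n → ℝ) → Fin n → ℝ) (β lam : Fin m → (Fin n → ℝ) → ℝ)
    (hα : ∀ i, ContDiff ℝ 2 (α i)) (hβ : ∀ i, ContDiff ℝ 2 (β i))
    (hlam : ∀ i, ContDiff ℝ 2 (lam i))
    (hsep : ∀ i : Fin m, i ≠ fst → i ≠ lst → ∀ xi w : Fin n → ℝ,
      f i xi w = xi ⬝ᵥ α i w + β i xi + lam i w)
    (hjac : ∀ i : Fin m, i ≠ fst → i ≠ lst → ∀ z ∈ closure Z,
      IsUnit (jacobian (α i) z)) :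
    ∀ yb : Fin m → Fin n → ℝ, (∀ k, yb k ∈ M k) →
    ∀ Y : Fin m → Fin m → Fin n → ℝ, (∀ i k, Y i k ∈ closure (M k)) →
    (∀ i, Y i i = yb i) →
    ∀ v : Fin m → Fin n → ℝ, v fst = 0 → v lst = 0 →
      (Ttensor c fst lst yb Y v =
        -(∑ i ∈ Finset.univ.filter (fun i : Fin m => i ≠ fst ∧ i ≠ lst),
            v i ⬝ᵥ (((jacobian (α i) (zmin (Y i)))ᵀ *
              (∑ k, D2zz (f k) (Y i k) (zmin (Y i)))⁻¹ *
              jacobian (α i) (zmin (Y i))) *ᵥ v i))) ∧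
      (v ≠ 0 → Ttensor c fst lst yb Y v < 0) := by
  intro yb hyb Y hY hYd v hv1 hvm
  have hyb' : ∀ k, yb k ∈ closure (M k) := fun k => subset_closure (hyb k)
  have hfl : fst ≠ lst := fun h => by
    have := congrArg Fin.val h
    omega
  have hK : IsCompact (closure Z) := hZb.isCompact_closure
  have hint : Z ⊆ interior (closure Z) := interior_maximal subset_closure hZo
  have hcd : ∀ x : Fin m → Fin n → ℝ, (∀ k, x k ∈ closure (M k)) → ∀ k, ∀ w ∈ closure Z,
      ContDiffAt ℝ 2 (fun p : (Fin n → ℝ) × (Fin n → ℝ) => f k p.1 p.2) (x k, w) := by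
    intro x hx k w hw
    obtain ⟨U, hUo, hU, hfU⟩ := hf k
    exact hfU.contDiffAt (hUo.mem_nhds (hU ⟨hx k, hw⟩))
  have hpD2 : ∀ x : Fin m → Fin n → ℝ, (∀ k, x k ∈ closure (M k)) → ∀ i j, pD2 c i j x = _ :=
    fun x hx => pD2_eq hK (hcd x hx) (hint (hzZ x hx)) (hzmin x hx) (hzuniq x hx) (hA x hx) hcdef
  set mid := Finset.univ.filter (fun i : Fin m => i ≠ fst ∧ i ≠ lst) with hmid
  have hmem : ∀ {i}, i ∈ mid ↔ i ≠ fst ∧ i ≠ lst := by simp [hmid]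
  set A := ∑ k, D2zz (f k) (yb k) (zmin yb) with hAdef
  set B := fun i => D2zx (f i) (yb i) (zmin yb) with hB
  let g : Fin m → Fin m → ℝ := fun i j => v i ⬝ᵥ (((B i)ᵀ * A⁻¹ * B j) *ᵥ v j)
  let h : Fin m → ℝ := fun i => v i ⬝ᵥ (((jacobian (α i) (zmin (Y i)))ᵀ *
    (∑ k, D2zz (f k) (Y i k) (zmin (Y i)))⁻¹ * jacobian (α i) (zmin (Y i))) *ᵥ v i)
  have hoff : ∀ i j, i ≠ j → pD2 c i j yb = -((B i)ᵀ * A⁻¹ * B j) := fun i j hij => by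
    rw [hpD2 yb hyb', if_neg hij, zero_sub]
  have hmixed : ∀ j ∈ mid, ∀ i ∈ mid.erase j, v i ⬝ᵥ (pD2 c i j yb *ᵥ v j) = -g i j := by
    intro j _ i hi
    rw [hoff i j (Finset.ne_of_mem_erase hi), Matrix.neg_mulVec, dotProduct_neg]
  have hprod : ∀ i ∈ mid, ∀ j ∈ mid,
      v i ⬝ᵥ ((pD2 c i lst yb * (pD2 c fst lst yb)⁻¹ * pD2 c fst j yb) *ᵥ v j) = -g i j := by
    intro i hi j hj
    have hunit := hnd yb hyb
    rw [hoff _ _ hfl, ← Matrix.neg_mul] at hunit ⊢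
    rw [hoff i lst (hmem.1 hi).2, hoff fst j (hmem.1 hj).1.symm]
    have hcancel := mul_nonsing_inv_mul_cancel_middle hunit
    have : -((B i)ᵀ * A⁻¹ * B lst) * (-((B fst)ᵀ * A⁻¹) * B lst)⁻¹ * -((B fst)ᵀ * A⁻¹ * B j) =
        -((B i)ᵀ * A⁻¹ * (B lst * (-((B fst)ᵀ * A⁻¹) * B lst)⁻¹ * -((B fst)ᵀ * A⁻¹)) * B j) := by
      simp only [Matrix.mul_assoc, Matrix.neg_mul, Matrix.mul_neg]
    rw [this, hcancel, Matrix.mul_one, Matrix.neg_mulVec, dotProduct_neg]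
  have hdiag : ∀ i ∈ mid, v i ⬝ᵥ ((pD2 c i i (Y i) - pD2 c i i yb) *ᵥ v i) = g i i - h i := by
    intro i hi
    have hs := hsep i (hmem.1 hi).1 (hmem.1 hi).2
    rw [hpD2 yb hyb', hpD2 (Y i) (hY i), if_pos rfl, if_pos rfl, hYd i,
      D2xx_eq_of_separable (hα i) (hβ i) (hlam i) hs (yb i) (zmin (Y i)) (zmin yb),
      D2zx_eq_jacobian (hα i) (hβ i) (hlam i) hs (yb i) (zmin (Y i)),
      sub_sub_sub_cancel_left, Matrix.sub_mulVec, dotProduct_sub]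
  have hT : Ttensor c fst lst yb Y v = -∑ i ∈ mid, h i := by
    rw [Ttensor, ← hmid, Finset.sum_congr rfl fun j hj => Finset.sum_congr rfl (hmixed j hj),
      Finset.sum_congr rfl fun i hi => Finset.sum_congr rfl (hprod i hi),
      Finset.sum_congr rfl hdiag, Finset.sum_comm (s := mid) (t := mid)]
    have herase : ∀ j ∈ mid, ∑ i ∈ mid.erase j, -g i j = g j j + ∑ i ∈ mid, -g i j := by
      intro j hj
      rw [← Finset.add_sum_erase mid _ hj]
      ring
    rw [Finset.sum_congr rfl herase, Finset.sum_add_distrib, Finset.sum_sub_distrib]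
    ring
  refine ⟨hT, fun hv => ?_⟩
  have hpos : ∀ i ∈ mid, v i ≠ 0 → 0 < h i := by
    intro i hi hvi
    have hzi := hzZ (Y i) (hY i)
    have hlocal : IsLocalMin (fun w => ∑ k, f k (Y i k) w) (zmin (Y i)) :=
      Filter.mem_of_superset (hZo.mem_nhds hzi) fun w hw =>
        hzmin (Y i) (hY i) w (subset_closure hw)
    have hpd := (posDef_sum_D2zz (fun k => hcd (Y i) (hY i) k _ (subset_closure hzi)) hlocal
      (hA (Y i) (hY i))).inv.conjTranspose_mul_mul_same (Matrix.mulVec_injective_of_isUnit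
        (hjac i (hmem.1 hi).1 (hmem.1 hi).2 _ (subset_closure hzi)))
    simpa [h, Matrix.conjTranspose_eq_transpose_of_trivial] using hpd.dotProduct_mulVec_pos hvi
  rw [hT, neg_lt_zero]
  obtain ⟨i, hi⟩ := Function.ne_iff.1 hv
  have him : i ∈ mid := hmem.2 ⟨fun h => hi (h ▸ hv1), fun h => hi (h ▸ hvm)⟩
  refine Finset.sum_pos' (fun j hj => ?_) ⟨i, him, hpos i him hi⟩
  by_cases hvj : v j = 0
  · simp [h, hvj]
  · exact (hpos j hj hvj).le
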